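/- (Wick's formula.) Let X = (X₁,…,X_{2n}) be a centered Gaussian random vector in ℝ^{2n} with covariance matrix C(i,j) = E[X_i X_j]. Then E[X₁·X₂⋯X_{2n}] = Σ_{M} Π_{{a,b} ∈ M} C(a,b), where the sum ranges over all perfect matchings M of the index set {1,…,2n} (partitions of {1,…,2n} into n unordered pairs). -/

import Mathlib

open MeasureTheory ProbabilityTheory

section wickaux

set_option linter.unusedSectionVars false

variable {Ω : Type*} [MeasurableSpace Ω] {P : Measure Ω}
  {ι : Type*} [Fintype ι] [LinearOrder ι] {X : ι → Ω → ℝ}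

/-- exponential of a linear combination -/
noncomputable def wE (X : ι → Ω → ℝ) (t : ι → ℝ) (ω : Ω) : ℝ := Real.exp (∑ i, t i * X i ω)

lemma wE_shift (t : ι → ℝ) (j : ι) (s : ℝ) (ω : Ω) :
    wE X (t + s • Pi.single j (1 : ℝ)) ω = wE X t ω * Real.exp (s * X j ω) := by
  unfold wE
  rw [← Real.exp_add]
  congr 1
  simp [add_mul, Finset.sum_add_distrib, Pi.single_apply]

lemma wE_pos (t : ι → ℝ) (ω : Ω) : 0 < wE X t ω := Real.exp_pos _

lemma wE_meas (hX : ∀ i, Measurable (X i)) (t : ι → ℝ) : Measurable (wE X t) := by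
  unfold wE; fun_prop

lemma abs_le_exp_add (x : ℝ) : |x| ≤ Real.exp x + Real.exp (-x) := by
  have h1 := Real.add_one_le_exp x
  have h2 := Real.add_one_le_exp (-x)
  have h3 := Real.exp_pos x
  have h4 := Real.exp_pos (-x)
  rcases abs_cases x with ⟨h, _⟩ | ⟨h, _⟩ <;> rw [h] <;> linarith

lemma w_int_step (hX : ∀ i, Measurable (X i)) {G : Ω → ℝ} (hG : Measurable G)
    (h : ∀ t, Integrable (fun ω => G ω * wE X t ω) P) (j : ι) (t : ι → ℝ) :
    Integrable (fun ω => (X j ω * G ω) * wE X t ω) P := by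
  have h1 := (h (t + (1 : ℝ) • Pi.single j (1 : ℝ))).norm.add
    (h (t + (-1 : ℝ) • Pi.single j (1 : ℝ))).norm
  have := wE_meas hX t
  refine h1.mono' (by fun_prop) (Filter.Eventually.of_forall fun ω => ?_)
  simp only [Pi.add_apply, wE_shift, norm_mul, Real.norm_eq_abs, Real.abs_exp]
  have := abs_le_exp_add (X j ω)
  have h0 : 0 ≤ |G ω| * |wE X t ω| := by positivity
  have := mul_le_mul_of_nonneg_left this h0
  simp only [one_mul, neg_mul]
  nlinarith

lemma w_prod_meas (hX : ∀ i, Measurable (X i)) (S : Finset ι) :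
    Measurable (fun ω => ∏ i ∈ S, X i ω) := by fun_prop

lemma w_int (hX : ∀ i, Measurable (X i)) (h : ∀ t, Integrable (wE X t) P) (S : Finset ι) :
    ∀ t, Integrable (fun ω => (∏ i ∈ S, X i ω) * wE X t ω) P := by
  induction S using Finset.induction_on with
  | empty => simpa using h
  | insert j S hj ih =>
    intro t
    simp only [Finset.prod_insert hj]
    exact w_int_step hX (w_prod_meas hX S) ih j t

/-- tilted moments -/
noncomputable def wF (P : Measure Ω) (X : ι → Ω → ℝ) (S : Finset ι) (t : ι → ℝ) : ℝ :=
  ∫ ω, (∏ i ∈ S, X i ω) * wE X t ω ∂P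

lemma w_deriv_aux (G E Y : Ω → ℝ)
    (h0 : ∀ s : ℝ, Integrable (fun ω => G ω * (E ω * Real.exp (s * Y ω))) P)
    (h1 : ∀ s : ℝ, Integrable (fun ω => (Y ω * G ω) * (E ω * Real.exp (s * Y ω))) P) :
    HasDerivAt (fun s : ℝ => ∫ ω, G ω * (E ω * Real.exp (s * Y ω)) ∂P)
      (∫ ω, (Y ω * G ω) * (E ω * Real.exp (0 * Y ω)) ∂P) 0 := by
  have hb : ∀ᵐ ω ∂P, ∀ s ∈ Metric.ball (0 : ℝ) 1,
      ‖(Y ω * G ω) * (E ω * Real.exp (s * Y ω))‖ ≤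
      ‖(Y ω * G ω) * (E ω * Real.exp (1 * Y ω))‖
      + ‖(Y ω * G ω) * (E ω * Real.exp (-1 * Y ω))‖ := by
    refine Filter.Eventually.of_forall fun ω s hs => ?_
    simp only [norm_mul, Real.norm_eq_abs, Real.abs_exp]
    rw [← mul_add, ← mul_add]
    refine mul_le_mul_of_nonneg_left (mul_le_mul_of_nonneg_left ?_ (abs_nonneg _)) (by positivity)
    rw [Metric.mem_ball, dist_zero_right, Real.norm_eq_abs, abs_lt] at hs
    rcases le_total 0 (Y ω) with hx | hx
    · have : Real.exp (s * Y ω) ≤ Real.exp (1 * Y ω) := Real.exp_le_exp.2 (by nlinarith)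
      linarith [Real.exp_pos (-1 * Y ω)]
    · have : Real.exp (s * Y ω) ≤ Real.exp (-1 * Y ω) := Real.exp_le_exp.2 (by nlinarith)
      linarith [Real.exp_pos (1 * Y ω)]
  have hd : ∀ᵐ ω ∂P, ∀ s ∈ Metric.ball (0 : ℝ) 1,
      HasDerivAt (fun s : ℝ => G ω * (E ω * Real.exp (s * Y ω)))
        ((Y ω * G ω) * (E ω * Real.exp (s * Y ω))) s := by
    refine Filter.Eventually.of_forall fun ω s hs => ?_
    have := ((((hasDerivAt_id s).mul_const (Y ω)).exp).const_mul (E ω)).const_mul (G ω)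
    simp only [id] at this
    refine this.congr_deriv ?_
    ring
  exact (hasDerivAt_integral_of_dominated_loc_of_deriv_le (μ := P)
    (F := fun (s : ℝ) ω => G ω * (E ω * Real.exp (s * Y ω)))
    (F' := fun (s : ℝ) ω => (Y ω * G ω) * (E ω * Real.exp (s * Y ω)))
    (x₀ := 0) (Metric.ball_mem_nhds _ one_pos)
    (Filter.Eventually.of_forall fun s => (h0 s).aestronglyMeasurable)
    (h0 0) (h1 0).aestronglyMeasurable hb ((h1 1).norm.add (h1 (-1)).norm) hd).2

lemma wF_deriv (hX : ∀ i, Measurable (X i)) (h : ∀ t, Integrable (wE X t) P) (S : Finset ι)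
    {j : ι} (hj : j ∉ S) (t : ι → ℝ) :
    HasDerivAt (fun s : ℝ => wF P X S (t + s • Pi.single j (1 : ℝ))) (wF P X (insert j S) t) 0 := by
  have hS := fun s : ℝ => w_int hX h S (t + s • Pi.single j (1 : ℝ))
  have hS' := fun s : ℝ => w_int hX h (insert j S) (t + s • Pi.single j (1 : ℝ))
  simp only [wE_shift, Finset.prod_insert hj] at hS hS'
  have := w_deriv_aux _ _ _ hS hS'
  simp only [wF, wE_shift, Finset.prod_insert hj]
  simpa only [zero_mul, Real.exp_zero, mul_one] using this

lemma wF_rec (hX : ∀ i, Measurable (X i)) (h : ∀ t, Integrable (wE X t) P)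
    (C : ι → ι → ℝ) (hsymm : ∀ i j, C i j = C j i)
    (hM : ∀ t, wF P X ∅ t = Real.exp ((∑ i, ∑ j, t i * t j * C i j) / 2)) (S : Finset ι) :
    ∀ i ∉ S, ∀ t, wF P X (insert i S) t =
      (∑ j, C i j * t j) * wF P X S t + ∑ k ∈ S, C i k * wF P X (S.erase k) t := by
  induction S using Finset.induction_on with
  | empty =>
    intro i hi t
    have h1 := wF_deriv hX h ∅ hi t
    have h2 : HasDerivAt (fun s : ℝ => wF P X ∅ (t + s • Pi.single i (1 : ℝ)))
        ((∑ j, C i j * t j) * wF P X ∅ t) 0 := by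
      have hq : ∀ s : ℝ, (∑ a, ∑ b, (t + s • Pi.single i (1 : ℝ) : ι → ℝ) a *
          (t + s • Pi.single i (1 : ℝ) : ι → ℝ) b * C a b) =
          (∑ a, ∑ b, t a * t b * C a b) + 2 * s * (∑ j, C i j * t j) + s ^ 2 * C i i := by
        intro s
        have e1 : ∀ a b, (t + s • Pi.single i (1 : ℝ) : ι → ℝ) a *
          (t + s • Pi.single i (1 : ℝ) : ι → ℝ) b * C a b = t a * t b * C a b
            + (if b = i then s * t a * C a i else 0)
            + (if a = i then s * t b * C i b else 0)
            + (if a = i then (if b = i then s ^ 2 * C i i else 0) else 0) := by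
          intro a b
          simp only [Pi.add_apply, Pi.smul_apply, Pi.single_apply, smul_eq_mul]
          split_ifs <;> subst_vars <;> ring
        simp only [e1, Finset.sum_add_distrib]
        have e2 : ∀ a, (∑ b, if a = i then s * t b * C i b else 0)
            = if a = i then ∑ b, s * t b * C i b else 0 := by
          intro a; split_ifs <;> simp
        have e3 : ∀ a, (∑ b, if a = i then (if b = i then s ^ 2 * C i i else 0) else 0)
            = if a = i then s ^ 2 * C i i else 0 := by
          intro a; split_ifs <;> simp
        simp only [e2, e3, Finset.sum_ite_eq', Finset.mem_univ, if_true]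
        have e4 : ∑ a, s * t a * C a i = s * ∑ j, C i j * t j := by
          rw [Finset.mul_sum]; refine Finset.sum_congr rfl fun a _ => ?_
          rw [hsymm a i]; ring
        have e5 : ∑ a, s * t a * C i a = s * ∑ j, C i j * t j := by
          rw [Finset.mul_sum]; refine Finset.sum_congr rfl fun a _ => ?_
          ring
        rw [e4, e5]; ring
      simp only [hM, hq]
      generalize (∑ a, ∑ b, t a * t b * C a b) = q
      generalize (∑ j, C i j * t j) = r
      have a1 : HasDerivAt (fun s : ℝ => (q + 2 * s * r + s ^ 2 * C i i) / 2) r 0 := by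
        have := (((((hasDerivAt_id (0:ℝ)).const_mul 2).mul_const r).const_add q).add
          (((hasDerivAt_id (0:ℝ)).pow 2).mul_const (C i i))).div_const 2
        refine this.congr_deriv ?_
        simp
      convert a1.exp using 1
      simp [mul_comm]
    simpa using h1.unique h2
  | insert j S hj ih =>
    intro i hi t
    rw [Finset.mem_insert, not_or] at hi
    have hji : j ∉ insert i S := by simp [hj, Ne.symm hi.1]
    have h1 := wF_deriv hX h (insert i S) hji t
    have hl : HasDerivAt (fun s : ℝ => ∑ k, C i k * (t + s • Pi.single j (1 : ℝ) : ι → ℝ) k)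
        (C i j) 0 := by
      have : ∀ s : ℝ, ∑ k, C i k * (t + s • Pi.single j (1 : ℝ) : ι → ℝ) k
          = (∑ k, C i k * t k) + s * C i j := by
        intro s
        simp [mul_add, Finset.sum_add_distrib, Pi.single_apply, mul_comm]
      simp only [this]
      simpa using ((hasDerivAt_id (0:ℝ)).mul_const (C i j)).const_add (∑ k, C i k * t k)
    have h2 := (hl.mul (wF_deriv hX h S hj t)).add
      (HasDerivAt.fun_sum (u := S) fun k _ => (wF_deriv hX h (S.erase k)
        (fun hh => hj (Finset.mem_of_mem_erase hh)) t).const_mul (C i k))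
    have h3 := h1.unique (h2.congr_of_eventuallyEq
      (Filter.Eventually.of_forall fun s => ih i hi.2 _))
    rw [Finset.insert_comm, h3, Finset.sum_insert hj, Finset.erase_insert hj]
    have : ∑ k ∈ S, C i k * wF P X ((insert j S).erase k) t
        = ∑ k ∈ S, C i k * wF P X (insert j (S.erase k)) t := by
      refine Finset.sum_congr rfl fun k hk => ?_
      rw [Finset.erase_insert_of_ne (by rintro rfl; exact hj hk)]
    rw [this]
    simp
    ring

/-- matchings of S -/
noncomputable def wM (S : Finset ι) : Finset (Equiv.Perm ι) :=
  Finset.univ.filter (fun f => (∀ i, f (f i) = i) ∧ ∀ i, f i ≠ i ↔ i ∈ S)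

noncomputable def wG (C : ι → ι → ℝ) (S : Finset ι) : ℝ :=
  ∑ f ∈ wM S, ∏ i ∈ Finset.univ.filter (fun i => i < f i), C i (f i)

lemma wG_empty (C : ι → ι → ℝ) : wG C ∅ = 1 := by
  have : wM (∅ : Finset ι) = {1} := by
    ext f
    simp only [wM, Finset.mem_filter, Finset.mem_univ, true_and, Finset.mem_singleton]
    constructor
    · rintro ⟨_, h⟩; ext i; simpa using h i
    · rintro rfl; simp
  simp [wG, this]

lemma wG_rec (C : ι → ι → ℝ) (S : Finset ι) (i : ι) (hi : ∀ k ∈ S, i < k) :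
    wG C (insert i S) = ∑ k ∈ S, C i k * wG C (S.erase k) := by
  have hiS : i ∉ S := fun h => lt_irrefl _ (hi i h)
  unfold wG
  rw [← Finset.sum_fiberwise_of_maps_to (s := wM (insert i S)) (t := S) (g := fun f => f i)]
  swap
  · intro f hf
    simp only [wM, Finset.mem_filter, Finset.mem_univ, true_and] at hf
    have h1 : f i ≠ i := (hf.2 i).2 (by simp)
    have h2 := (hf.2 (f i)).1 (by rw [hf.1]; exact h1.symm)
    simpa [h1] using h2
  refine Finset.sum_congr rfl fun k hk => ?_
  have hik := hi k hk
  rw [Finset.mul_sum]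
  refine Finset.sum_bij' (fun f _ => Equiv.swap i k * f) (fun f _ => Equiv.swap i k * f)
    ?_ ?_ ?_ ?_ ?_
  · intro f hf
    simp only [wM, Finset.mem_filter, Finset.mem_univ, true_and, Equiv.Perm.mul_apply,
      Finset.mem_insert, Finset.mem_erase] at hf ⊢
    obtain ⟨⟨h1, h2⟩, h3⟩ := hf
    have h4 : f k = i := by rw [← h3, h1]
    constructor
    · intro j
      have := h1 j
      simp only [Equiv.swap_apply_def]
      grind
    · intro j
      have := h1 j
      have := h2 j
      simp only [Equiv.swap_apply_def]
      grind
  · intro f hf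
    simp only [wM, Finset.mem_filter, Finset.mem_univ, true_and, Equiv.Perm.mul_apply,
      Finset.mem_insert, Finset.mem_erase] at hf ⊢
    obtain ⟨h1, h2⟩ := hf
    have h3 : f i = i := by have := h2 i; grind
    have h4 : f k = k := by have := h2 k; grind
    refine ⟨⟨?_, ?_⟩, by simp [h3]⟩
    · intro j
      have := h1 j
      simp only [Equiv.swap_apply_def]
      grind
    · intro j
      have := h1 j
      have := h2 j
      simp only [Equiv.swap_apply_def]
      grind
  · intro f _; simp [← mul_assoc]
  · intro f _; simp [← mul_assoc]
  · intro f hf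
    simp only [wM, Finset.mem_filter, Finset.mem_univ, true_and, Finset.mem_insert] at hf
    obtain ⟨⟨h1, h2⟩, h3⟩ := hf
    have h4 : f k = i := by rw [← h3, h1]
    have h5 : ∀ j, j ≠ i → j ≠ k → (Equiv.swap i k * f) j = f j := by
      intro j hj hj'
      have := h1 j
      simp only [Equiv.Perm.mul_apply, Equiv.swap_apply_def]
      grind
    have h6 : (Equiv.swap i k * f) i = i := by simp [h3]
    have h7 : (Equiv.swap i k * f) k = k := by simp [h4]
    have hs : Finset.univ.filter (fun j => j < f j) =
        insert i (Finset.univ.filter (fun j => j < (Equiv.swap i k * f) j)) := by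
      ext j
      simp only [Finset.mem_filter, Finset.mem_univ, true_and, Finset.mem_insert]
      by_cases hj : j = i
      · subst hj; simp [h3, hik]
      by_cases hj' : j = k
      · subst hj'; rw [h7, h4]; simp [hj, hik.le]
      · rw [h5 j hj hj']; simp [hj]
    rw [hs, Finset.prod_insert (by simp only [Finset.mem_filter, h6]; simp), h3]
    congr 1
    refine Finset.prod_congr rfl fun j hj => ?_
    simp only [Finset.mem_filter, Finset.mem_univ, true_and] at hj
    rw [h5 j (by rintro rfl; rw [h6] at hj; exact lt_irrefl _ hj)
      (by rintro rfl; rw [h7] at hj; exact lt_irrefl _ hj)]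

lemma w_main (C : ι → ι → ℝ) (m : Finset ι → ℝ) (h0 : m ∅ = 1)
    (hm : ∀ S : Finset ι, ∀ i ∉ S, m (insert i S) = ∑ k ∈ S, C i k * m (S.erase k))
    (S : Finset ι) : m S = wG C S := by
  induction S using Finset.strongInduction with
  | H S ih =>
    rcases S.eq_empty_or_nonempty with rfl | hne
    · rw [h0, wG_empty]
    · set i := S.min' hne with hidef
      have hiS : i ∈ S := S.min'_mem hne
      have hins : insert i (S.erase i) = S := Finset.insert_erase hiS
      have hlt : ∀ k ∈ S.erase i, i < k := fun k hk =>
        lt_of_le_of_ne (S.min'_le k (Finset.mem_of_mem_erase hk)) (Finset.ne_of_mem_erase hk).symm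
      rw [← hins, hm _ i (Finset.notMem_erase _ _), wG_rec C _ i hlt]
      refine Finset.sum_congr rfl fun k hk => ?_
      rw [ih]
      exact (Finset.erase_ssubset hk).trans (Finset.erase_ssubset hiS)

lemma w_final [IsProbabilityMeasure P] (hX : ∀ i, Measurable (X i)) (C : ι → ι → ℝ)
    (hC : ∀ i j, C i j = ∫ ω, X i ω * X j ω ∂P)
    (hgauss : ∀ a : ι → ℝ,
      P.map (fun ω => ∑ i, a i * X i ω)
        = gaussianReal 0 (∑ i, ∑ j, a i * a j * C i j).toNNReal) :
    ∫ ω, ∏ i, X i ω ∂P = wG C Finset.univ := by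
  have h : ∀ t, Integrable (wE X t) P := by
    intro t
    have h1 := integrable_exp_mul_gaussianReal (μ := 0)
      (v := (∑ i, ∑ j, t i * t j * C i j).toNNReal) 1
    rw [← hgauss t, integrable_map_measure (by fun_prop) (by fun_prop)] at h1
    change Integrable (fun ω => wE X t ω) P
    simpa [wE, Function.comp_def] using h1
  have hsymm : ∀ i j, C i j = C j i := by
    intro i j; rw [hC, hC]; simp only [mul_comm]
  have hint : ∀ i j, Integrable (fun ω => X i ω * X j ω) P := by
    intro i j
    have h1 := w_int_step (P := P) hX (G := fun _ => 1) measurable_const (by simpa using h) j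
    have h2 := w_int_step (P := P) hX (G := fun ω => X j ω * 1) (by fun_prop) h1 i 0
    simpa [wE] using h2
  have hpos : ∀ t : ι → ℝ, 0 ≤ ∑ i, ∑ j, t i * t j * C i j := by
    intro t
    have : ∑ i, ∑ j, t i * t j * C i j = ∫ ω, (∑ i, t i * X i ω) ^ 2 ∂P := by
      have e : ∀ ω, (∑ i, t i * X i ω) ^ 2 = ∑ i, ∑ j, t i * t j * (X i ω * X j ω) := by
        intro ω
        rw [sq, Finset.sum_mul_sum]
        refine Finset.sum_congr rfl fun i _ => Finset.sum_congr rfl fun j _ => by ring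
      simp only [e]
      rw [integral_finsetSum _ fun i _ => integrable_finsetSum _ fun j _ => (hint i j).const_mul _]
      refine Finset.sum_congr rfl fun i _ => ?_
      rw [integral_finsetSum _ fun j _ => (hint i j).const_mul _]
      refine Finset.sum_congr rfl fun j _ => ?_
      rw [integral_const_mul, hC]
    rw [this]
    exact integral_nonneg fun ω => sq_nonneg _
  have hM : ∀ t, wF P X ∅ t = Real.exp ((∑ i, ∑ j, t i * t j * C i j) / 2) := by
    intro t
    have := mgf_gaussianReal (hgauss t) 1
    simpa [mgf, wF, wE, Real.coe_toNNReal _ (hpos t)] using this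
  have := w_main C (fun S => wF P X S 0) (by simp [wF, wE]) (fun S i hi => by
    simpa using wF_rec hX h C hsymm hM S i hi 0) Finset.univ
  simpa [wF, wE] using this

end wickaux

open scoped Classical in
/-- Wick's formula: for a centered Gaussian vector `X = (X₁,…,X_{2n})` with covariance
matrix `C`, `E[X₁⋯X_{2n}] = Σ_M Π_{{a,b} ∈ M} C(a,b)`, the sum running over all perfect
matchings `M` of `{1,…,2n}`, encoded here as fixed-point-free involutive permutations `f`,
each pair `{a, b}` (with `a < b = f a`) contributing a factor `C a b`. -/
theorem wick_formula (n : ℕ) {Ω : Type*} [MeasurableSpace Ω] (P : Measure Ω)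
    [IsProbabilityMeasure P]
    (X : Fin (2 * n) → Ω → ℝ) (hX : ∀ i, Measurable (X i))
    (C : Matrix (Fin (2 * n)) (Fin (2 * n)) ℝ)
    (hC : ∀ i j, C i j = ∫ ω, X i ω * X j ω ∂P)
    (hgauss : ∀ a : Fin (2 * n) → ℝ,
      P.map (fun ω => ∑ i, a i * X i ω)
        = gaussianReal 0 (∑ i, ∑ j, a i * a j * C i j).toNNReal) :
    ∫ ω, ∏ i, X i ω ∂P =
      ∑ f ∈ Finset.univ.filter
          (fun f : Equiv.Perm (Fin (2 * n)) => (∀ i, f (f i) = i) ∧ ∀ i, f i ≠ i),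
        ∏ i ∈ Finset.univ.filter (fun i => i < f i), C i (f i) := by
  rw [w_final hX C hC hgauss]
  unfold wG wM
  refine Finset.sum_congr ?_ fun f _ => ?_
  · ext f; simp
  · refine Finset.prod_congr ?_ fun _ _ => rfl
    ext i; simp
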